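/- arXiv:1705.10395 — 2 statements merged into one kernel-verified Lean document; each statement's English description precedes it below -/
import Mathlib

section
/- The polynomial P(T) is irreducible over ℚ, and there is no polynomial g ∈ ℤ[T] and no integer k ≥ 2 such that P(T) = g(T^k). -/
open Polynomial

/-- The Weil polynomial `P(T) = Q₁(J(X)/𝔽₃, T)` of the intermediate Jacobian of the
cubic threefold `X` of the paper over `𝔽₃`. -/
noncomputable def weilP : Polynomial ℤ :=
  X ^ 10 - 6 * X ^ 9 + 15 * X ^ 8 - 10 * X ^ 7 - 41 * X ^ 6 + 125 * X ^ 5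
    - 123 * X ^ 4 - 90 * X ^ 3 + 405 * X ^ 2 - 486 * X + 243

/-- The coefficient of a product, as a sum over `Finset.range`. -/
theorem coeff_mul_eq_sum_range {R : Type*} [CommRing R] (f g : R[X]) (n : ℕ) :
    (f * g).coeff n = ∑ i ∈ Finset.range (n + 1), f.coeff i * g.coeff (n - i) := by
  rw [coeff_mul, Finset.Nat.sum_antidiagonal_eq_sum_range_succ_mk]

theorem natDegree_quintic {R : Type*} [CommRing R] [Nontrivial R] (a b c : R) :
    (X ^ 5 + C a * X ^ 4 + C b * X + C c).natDegree = 5 := by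
  compute_degree!

theorem monic_quintic {R : Type*} [CommRing R] [Nontrivial R] (a b c : R) :
    (X ^ 5 + C a * X ^ 4 + C b * X + C c).Monic := by
  monicity!

/-- A quintic `X ^ 5 + a X ^ 4 + b X + c` is irreducible as soon as it has no root and its
remainder modulo every monic quadratic `X ^ 2 + r X + s` is nonzero. -/
theorem irreducible_quintic {R : Type*} [CommRing R] [IsDomain R] (a b c : R)
    (hroot : ∀ x : R, x ^ 5 + a * x ^ 4 + b * x + c ≠ 0)
    (hquad : ∀ r s : R,
      r * (r * (s + r * (a - r)) - s * (a - r)) - s * (s + r * (a - r)) = b →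
        s * (r * (s + r * (a - r)) - s * (a - r)) ≠ c) :
    Irreducible (X ^ 5 + C a * X ^ 4 + C b * X + C c) := by
  have hp := monic_quintic a b c
  have hd := natDegree_quintic a b c
  rw [hp.irreducible_iff_natDegree']
  refine ⟨fun h => by simp [h] at hd, fun f g hf hg hfg hmem => ?_⟩
  have hsum : f.natDegree + g.natDegree = 5 := by rw [← hf.natDegree_mul hg, hfg, hd]
  rw [hd, Finset.mem_Ioc] at hmem
  obtain hg1 | hg2 : g.natDegree = 1 ∨ g.natDegree = 2 := by lia
  · have hroot' := congrArg (eval (-g.coeff 0)) hfg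
    rw [hg.eq_X_add_C hg1] at hroot'
    refine hroot (-g.coeff 0) ?_
    simpa using hroot'.symm
  · have hf3 : f.natDegree = 3 := by lia
    have f3 : f.coeff 3 = 1 := hf3 ▸ hf.coeff_natDegree
    have g2 : g.coeff 2 = 1 := hg2 ▸ hg.coeff_natDegree
    have f4 : f.coeff 4 = 0 := coeff_eq_zero_of_natDegree_lt (by lia)
    have g3 : g.coeff 3 = 0 := coeff_eq_zero_of_natDegree_lt (by lia)
    have g4 : g.coeff 4 = 0 := coeff_eq_zero_of_natDegree_lt (by lia)
    have key (n : ℕ) := congrArg (coeff · n) hfg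
    simp only [coeff_mul_eq_sum_range] at key
    have e0 := key 0
    have e1 := key 1
    have e2 := key 2
    have e3 := key 3
    have e4 := key 4
    simp [Finset.sum_range_succ, f3, f4, g2, g3, g4, coeff_X, coeff_C] at e0 e1 e2 e3 e4
    have h2 : f.coeff 2 = a - g.coeff 1 := by linear_combination e4
    rw [h2] at e3 e2
    have h1 : f.coeff 1 = -(g.coeff 0 + g.coeff 1 * (a - g.coeff 1)) := by
      linear_combination e3
    rw [h1] at e2 e1
    have h0 : f.coeff 0 = g.coeff 1 * (g.coeff 0 + g.coeff 1 * (a - g.coeff 1))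
        - g.coeff 0 * (a - g.coeff 1) := by
      linear_combination e2
    rw [h0] at e1 e0
    exact hquad (g.coeff 1) (g.coeff 0) (by linear_combination e1) (by linear_combination e0)

theorem natDegree_weilP : weilP.natDegree = 10 := by
  unfold weilP
  compute_degree!

theorem monic_weilP : weilP.Monic := by
  unfold weilP
  monicity!

instance fact_prime_five : Fact (Nat.Prime 5) := ⟨Nat.prime_five⟩

/-- Modulo `5` the polynomial is a product of two irreducible quintics. -/
theorem weilP_map_zmod_five :
    weilP.map (Int.castRingHom (ZMod 5)) =
      (X ^ 5 + C 4 * X ^ 4 + C 0 * X + C 1) * (X ^ 5 + C 0 * X ^ 4 + C 4 * X + C 3) := by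
  have h5 : (C 5 : (ZMod 5)[X]) = 0 := by rw [show (5 : ZMod 5) = 0 from rfl, C_0]
  simp only [weilP, Polynomial.map_add, Polynomial.map_sub, Polynomial.map_mul,
    Polynomial.map_pow, Polynomial.map_X, Polynomial.map_ofNat, map_ofNat, map_zero, map_one]
    at h5 ⊢
  linear_combination (-2 * X ^ 9 + 3 * X ^ 8 - 2 * X ^ 7 - 9 * X ^ 6 + 21 * X ^ 5
    - 27 * X ^ 4 - 18 * X ^ 3 + 81 * X ^ 2 - 98 * X + 48) * h5

/-- A divisor of `weilP` modulo `5` of degree less than five is constant. -/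
theorem natDegree_eq_zero_of_dvd_weilP_map_zmod_five {q : (ZMod 5)[X]}
    (hq : q ∣ weilP.map (Int.castRingHom (ZMod 5))) (hlt : q.natDegree < 5) :
    q.natDegree = 0 := by
  have hu : Irreducible (X ^ 5 + C 4 * X ^ 4 + C 0 * X + C 1 : (ZMod 5)[X]) :=
    irreducible_quintic _ _ _ (by decide) (by decide)
  have hv : Irreducible (X ^ 5 + C 0 * X ^ 4 + C 4 * X + C 3 : (ZMod 5)[X]) :=
    irreducible_quintic _ _ _ (by decide) (by decide)
  have hq0 : q ≠ 0 := by
    rintro rfl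
    exact (monic_weilP.map (Int.castRingHom (ZMod 5))).ne_zero (zero_dvd_iff.mp hq)
  have hcop {p : (ZMod 5)[X]} (hp : Irreducible p) (hd : p.natDegree = 5) : IsCoprime q p :=
    (hp.coprime_iff_not_dvd.mpr fun h => by
      have := natDegree_le_of_dvd h hq0
      lia).symm
  rw [weilP_map_zmod_five] at hq
  exact natDegree_eq_zero_of_isUnit <|
    ((hcop hu (natDegree_quintic _ _ _)).mul_right
      (hcop hv (natDegree_quintic _ _ _))).isUnit_of_dvd' dvd_rfl hq

/-- Modulo `2` the polynomial is not a product of two monic quintics. -/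
theorem mul_ne_weilP_map_zmod_two {f g : (ZMod 2)[X]} (hf : f.Monic) (hg : g.Monic)
    (hf5 : f.natDegree = 5) (hg5 : g.natDegree = 5) :
    f * g ≠ weilP.map (Int.castRingHom (ZMod 2)) := by
  intro hfg
  have f5 : f.coeff 5 = 1 := hf5 ▸ hf.coeff_natDegree
  have g5 : g.coeff 5 = 1 := hg5 ▸ hg.coeff_natDegree
  have fz (n : ℕ) (hn : 5 < n) : f.coeff n = 0 := coeff_eq_zero_of_natDegree_lt (by lia)
  have gz (n : ℕ) (hn : 5 < n) : g.coeff n = 0 := coeff_eq_zero_of_natDegree_lt (by lia)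
  have key (n : ℕ) := congrArg (coeff · n) hfg
  simp only [coeff_mul_eq_sum_range, coeff_map] at key
  have e0 := key 0
  have e1 := key 1
  have e2 := key 2
  have e3 := key 3
  have e4 := key 4
  have e5 := key 5
  have e6 := key 6
  have e7 := key 7
  have e8 := key 8
  have e9 := key 9
  simp [Finset.sum_range_succ, f5, g5, fz, gz, weilP, coeff_X, coeff_X_pow,
    coeff_ofNat_mul, coeff_ofNat_zero, coeff_ofNat_succ] at e0 e1 e2 e3 e4 e5 e6 e7 e8 e9
  clear key fz gz f5 g5 hf5 hg5 hfg hf hg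
  generalize f.coeff 0 = a₀, f.coeff 1 = a₁, f.coeff 2 = a₂, f.coeff 3 = a₃, f.coeff 4 = a₄
    at e0 e1 e2 e3 e4 e5 e6 e7 e8 e9
  generalize g.coeff 0 = b₀, g.coeff 1 = b₁, g.coeff 2 = b₂, g.coeff 3 = b₃, g.coeff 4 = b₄
    at e0 e1 e2 e3 e4 e5 e6 e7 e8 e9
  obtain rfl := eq_sub_of_add_eq' e9
  obtain rfl := eq_sub_of_add_eq' e8
  obtain rfl := eq_sub_of_add_eq' e7
  obtain rfl := eq_sub_of_add_eq' e6
  obtain rfl := eq_sub_of_add_eq' e5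
  clear e5 e6 e7 e8 e9
  revert a₀ a₁ a₂ a₃ a₄
  decide

theorem irreducible_weilP : Irreducible weilP := by
  rw [monic_weilP.irreducible_iff_natDegree']
  refine ⟨fun h => by simpa [h] using natDegree_weilP, fun f g hf hg hfg hmem => ?_⟩
  have hsum : f.natDegree + g.natDegree = 10 := by
    rw [← hf.natDegree_mul hg, hfg, natDegree_weilP]
  rw [natDegree_weilP, Finset.mem_Ioc] at hmem
  by_cases hg5 : g.natDegree = 5
  · refine mul_ne_weilP_map_zmod_two (hf.map (Int.castRingHom (ZMod 2)))
      (hg.map (Int.castRingHom (ZMod 2))) ?_ ?_ (by rw [← Polynomial.map_mul, hfg])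
    · rw [hf.natDegree_map]; lia
    · rw [hg.natDegree_map]; lia
  · have hdeg := hg.natDegree_map (Int.castRingHom (ZMod 5))
    have := natDegree_eq_zero_of_dvd_weilP_map_zmod_five
      (q := g.map (Int.castRingHom (ZMod 5)))
      (Polynomial.map_dvd _ (Dvd.intro_left f hfg)) (by lia)
    lia

/-- `P(T)` is irreducible over `ℚ`, and there is no `g ∈ ℤ[T]` and no integer `k ≥ 2`
with `P(T) = g(T^k)`. -/
theorem weilP_irreducible_and_not_in_ZTk :
    Irreducible (weilP.map (Int.castRingHom ℚ)) ∧
      ∀ (g : Polynomial ℤ) (k : ℕ), 2 ≤ k → weilP ≠ Polynomial.expand ℤ k g := by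
  refine ⟨monic_weilP.isPrimitive.irreducible_iff_irreducible_map_fraction_map.mp
    irreducible_weilP, fun g k hk h => ?_⟩
  have h1 := congrArg (coeff · 1) h
  have hk1 : ¬ k ∣ 1 := fun h => by have := Nat.le_of_dvd one_pos h; lia
  simp [coeff_expand (by lia : 0 < k), hk1, weilP, coeff_X, coeff_X_pow, coeff_ofNat_mul,
    coeff_ofNat_succ] at h1
end

section
/- Let ω₁,…,ω₁₀ be the complex roots of P(T), counted with multiplicity. For each r ∈ {2, 3, 4, 6, 11, 22}, the monic polynomial P_r(T) = ∏_{i=1}^{10}(T − ωᵢ^r) has integer coefficients, is irreducible over ℚ, and there is no polynomial g ∈ ℤ[T] and no integer k ≥ 2 such that P_r(T) = g(T^k). -/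
open Polynomial

section Coefficients

variable {R : Type*} [CommRing R]

/-- The polynomial with the given list of coefficients, constant term first. -/
noncomputable def ofCoeffs (l : List R) : R[X] :=
  l.foldr (fun c q => C c + X * q) 0

@[simp]
theorem ofCoeffs_nil : ofCoeffs ([] : List R) = 0 := rfl

@[simp]
theorem ofCoeffs_cons (c : R) (l : List R) : ofCoeffs (c :: l) = C c + X * ofCoeffs l := rfl

theorem coeff_ofCoeffs (l : List R) (i : ℕ) : (ofCoeffs l).coeff i = l.getD i 0 := by
  induction l generalizing i with
  | nil => simp
  | cons c l ih => cases i <;> simp [coeff_C, ih]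

theorem map_ofCoeffs {S : Type*} [CommRing S] (f : R →+* S) (l : List R) :
    (ofCoeffs l).map f = ofCoeffs (l.map f) := by
  induction l with
  | nil => simp
  | cons c l ih => simp [ih]

theorem degree_ofCoeffs_lt (l : List R) : (ofCoeffs l).degree < l.length := by
  rw [degree_lt_iff_coeff_zero]
  intro m hm
  rw [coeff_ofCoeffs, List.getD_eq_default _ _ hm]

theorem Polynomial.Monic.eq_X_pow_add_ofCoeffs {g : R[X]} (hg : g.Monic) :
    g = X ^ g.natDegree + ofCoeffs ((List.range g.natDegree).map g.coeff) := by
  ext i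
  rw [coeff_add, coeff_X_pow, coeff_ofCoeffs]
  rcases lt_trichotomy i g.natDegree with h | rfl | h
  · simp [List.getD, h, h.ne]
  · simp [List.getD, hg]
  · simp [List.getD, coeff_eq_zero_of_natDegree_lt h, h.ne', h.le]

/-- Coefficients of the remainder of `ofCoeffs l` modulo the monic polynomial
`X ^ a.length + ofCoeffs a`. -/
def remCoeffs (a : List R) : List R → List R
  | [] => List.replicate a.length 0
  | c :: l =>
    let r := c :: remCoeffs a l
    let t := r.getLastD 0
    List.zipWith (fun u v => u - t * v) r a

theorem length_remCoeffs (a l : List R) : (remCoeffs a l).length = a.length := by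
  induction l with
  | nil => simp [remCoeffs]
  | cons c l ih => simp [remCoeffs, ih]

theorem ofCoeffs_zipWith_sub_mul (t : R) (a l : List R) (h : l.length = a.length + 1) :
    ofCoeffs (List.zipWith (fun u v => u - t * v) l a) =
      ofCoeffs l - C (l.getLastD 0) * X ^ a.length - C t * ofCoeffs a := by
  induction a generalizing l with
  | nil =>
    obtain ⟨c, rfl⟩ := List.length_eq_one_iff.mp h
    simp
  | cons b a ih =>
    match l, h with
    | c :: d :: l, h =>
      have := ih (d :: l) (by simpa using h)
      simp only [List.zipWith_cons_cons, ofCoeffs_cons, List.getLastD_cons, List.length_cons,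
        C_sub, C_mul] at this ⊢
      cases a with
      | nil =>
        simp at this ⊢
        linear_combination X * this
      | cons e a =>
        simp only [List.zipWith_cons_cons, ofCoeffs_cons, List.length_cons, C_sub, C_mul] at this ⊢
        linear_combination X * this

theorem dvd_ofCoeffs_sub_remCoeffs (a l : List R) :
    X ^ a.length + ofCoeffs a ∣ ofCoeffs l - ofCoeffs (remCoeffs a l) := by
  induction l with
  | nil =>
    have h : ofCoeffs (List.replicate a.length (0 : R)) = 0 := by
      ext i
      simp [coeff_ofCoeffs, List.getD]
    simp [remCoeffs, h]
  | cons c l ih =>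
    obtain ⟨q, hq⟩ := ih
    simp only [remCoeffs]
    rw [ofCoeffs_zipWith_sub_mul _ _ _ (by simp [length_remCoeffs])]
    set t := (c :: remCoeffs a l).getLastD 0
    refine ⟨X * q + C t, ?_⟩
    simp only [ofCoeffs_cons]
    linear_combination X * hq

theorem remCoeffs_eq_zero_of_dvd {g : R[X]} (hg : g.Monic) {l : List R} (h : g ∣ ofCoeffs l) :
    ∀ x ∈ remCoeffs ((List.range g.natDegree).map g.coeff) l, x = 0 := by
  nontriviality R
  set a := (List.range g.natDegree).map g.coeff with ha
  have hlen : a.length = g.natDegree := by simp [ha]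
  have hdvd : g ∣ ofCoeffs (remCoeffs a l) := by
    have h' := dvd_ofCoeffs_sub_remCoeffs a l
    rw [hlen, ha, ← hg.eq_X_pow_add_ofCoeffs, ← ha] at h'
    exact (dvd_sub_right h).mp h'
  have hzero : ofCoeffs (remCoeffs a l) = 0 := by
    by_contra hne
    refine hg.not_dvd_of_degree_lt hne ?_ hdvd
    have := degree_ofCoeffs_lt (remCoeffs a l)
    rwa [length_remCoeffs, hlen, ← degree_eq_natDegree hg.ne_zero] at this
  intro x hx
  obtain ⟨i, hi, rfl⟩ := List.getElem_of_mem hx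
  rw [← List.getD_eq_getElem _ 0 hi, ← coeff_ofCoeffs, hzero, coeff_zero]

/-- If no remainder modulo a monic polynomial of degree `d` with coefficients in `s` vanishes,
then `ofCoeffs l` has no monic factor of degree `d`. -/
theorem natDegree_ne_of_dvd_ofCoeffs {s : List R} (hs : ∀ x, x ∈ s) {d : ℕ} {l : List R}
    (h : ∀ a ∈ (List.replicate d s).sections, ∃ x ∈ remCoeffs a l, x ≠ 0)
    {g : R[X]} (hg : g.Monic) (hdvd : g ∣ ofCoeffs l) : g.natDegree ≠ d := by
  rintro rfl
  obtain ⟨x, hx, hx0⟩ := h ((List.range g.natDegree).map g.coeff) (by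
    rw [List.mem_sections, List.forall₂_iff_get]
    simp [hs])
  exact hx0 (remCoeffs_eq_zero_of_dvd hg hdvd x hx)

end Coefficients

/-- The coefficients of `weilP`, constant term first. -/
def weilPCoeffs : List ℤ := [243, -486, 405, -90, -123, 125, -41, -10, 15, -6, 1]

theorem weilP_eq_ofCoeffs : weilP = ofCoeffs weilPCoeffs := by
  simp only [weilP, weilPCoeffs, ofCoeffs_cons, ofCoeffs_nil, map_neg, map_ofNat, map_one]
  ring

theorem not_dvd_weilP_mod_five :
    ∀ d ∈ [1, 2, 3, 4], ∀ a ∈ (List.replicate d [(0 : ZMod 5), 1, 2, 3, 4]).sections,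
      ∃ x ∈ remCoeffs a (weilPCoeffs.map (Int.castRingHom (ZMod 5))), x ≠ 0 := by
  decide +kernel

theorem not_dvd_weilP_mod_two :
    ∀ a ∈ (List.replicate 5 [(0 : ZMod 2), 1]).sections,
      ∃ x ∈ remCoeffs a (weilPCoeffs.map (Int.castRingHom (ZMod 2))), x ≠ 0 := by
  decide +kernel

/-- In characteristic `5`, a root `x` of `weilP` is a polynomial expression in `x ^ 1320`. -/
theorem exists_aeval_pow_eq_of_root_weilP {A : Type*} [CommRing A] {x : A} (h5 : (5 : A) = 0)
    (hx : aeval x weilP = 0) : ∃ c : ℤ[X], aeval (x ^ 1320) c = x := by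
  have h : x ^ 10 - 6 * x ^ 9 + 15 * x ^ 8 - 10 * x ^ 7 - 41 * x ^ 6 + 125 * x ^ 5 - 123 * x ^ 4 -
      90 * x ^ 3 + 405 * x ^ 2 - 486 * x + 243 = 0 := by
    simpa only [weilP, map_add, map_sub, map_mul, map_pow, map_ofNat, aeval_X] using hx
  refine ⟨X ^ 9 - X ^ 8 - X ^ 7 - 2 * X ^ 6 - 2 * X ^ 5 + 2 * X ^ 4 - X ^ 3 + X ^ 2 - X, ?_⟩
  simp only [map_add, map_sub, map_mul, map_pow, map_ofNat, aeval_X]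
  have h11 : x ^ 11 = x ^ 9 + x ^ 7 + x ^ 6 - 2 * x ^ 5 - 2 * x ^ 4 + x ^ 2 - 2 * x + 2 := by
    linear_combination (x + 1) * h + (x ^ 10 - 2 * x ^ 9 - x ^ 8 + 10 * x ^ 7 - 17 * x ^ 6 +
      43 * x ^ 4 - 63 * x ^ 3 + 16 * x ^ 2 + 49 * x - 49) * h5
  have h22 : x ^ 22 = 2 * x ^ 9 - x ^ 8 - x ^ 7 - x ^ 6 - x ^ 5 + x ^ 4 + x - 1 := by
    rw [show x ^ 22 = x ^ 11 * x ^ 11 by ring, h11]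
    linear_combination (x ^ 8 + x ^ 7 - 2 * x ^ 6 - 2 * x ^ 4 + 2 * x ^ 3 + 2 * x) * h + (x ^ 17 -
      x ^ 16 - 3 * x ^ 15 + 16 * x ^ 14 - 24 * x ^ 13 - 9 * x ^ 12 + 81 * x ^ 11 - 123 * x ^ 10 +
      43 * x ^ 9 + 116 * x ^ 8 - 214 * x ^ 7 + 247 * x ^ 6 - 307 * x ^ 5 + 326 * x ^ 4 -
      260 * x ^ 3 + 196 * x ^ 2 - 99 * x + 1) * h5
  have h33 : x ^ 33 = 2 * x ^ 9 - x ^ 8 - x ^ 7 - x ^ 6 - 2 * x ^ 4 + x ^ 3 - 2 * x ^ 2 + x - 2 := by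
    rw [show x ^ 33 = x ^ 22 * x ^ 11 by ring, h22, h11]
    linear_combination (2 * x ^ 8 + x ^ 7 + 2 * x ^ 6 + 2 * x ^ 5 + 2 * x ^ 4 + x) * h +
      (2 * x ^ 17 - 5 * x ^ 16 + 3 * x ^ 15 + 13 * x ^ 14 - 42 * x ^ 13 + 39 * x ^ 12 +
      32 * x ^ 11 - 127 * x ^ 10 + 146 * x ^ 9 - 75 * x ^ 8 + 28 * x ^ 7 - 90 * x ^ 6 +
      121 * x ^ 5 - 78 * x ^ 4 - 81 * x ^ 3 + 97 * x ^ 2 - 48 * x) * h5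
  have h66 : x ^ 66 = -2 * x ^ 9 - 2 * x ^ 8 + x ^ 7 - 2 * x ^ 5 + 2 * x ^ 4 - 2 * x ^ 3 - 2 * x +
      1 := by
    rw [show x ^ 66 = x ^ 33 * x ^ 33 by ring, h33]
    linear_combination (-x ^ 8 + 2 * x ^ 6 + 2 * x ^ 4 + x ^ 3 - x ^ 2 - 2 * x + 1) * h + (x ^ 18 -
      2 * x ^ 17 + 2 * x ^ 16 - 14 * x ^ 14 + 30 * x ^ 13 - 11 * x ^ 12 - 69 * x ^ 11 +
      151 * x ^ 10 - 99 * x ^ 9 - 102 * x ^ 8 + 265 * x ^ 7 - 205 * x ^ 6 + 20 * x ^ 5 +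
      72 * x ^ 4 + 33 * x ^ 3 - 225 * x ^ 2 + 194 * x - 48) * h5
  have h132 : x ^ 132 = x ^ 9 - 2 * x ^ 7 + 2 * x ^ 6 + 2 * x ^ 5 - x ^ 4 - x ^ 2 - 2 * x - 1 := by
    rw [show x ^ 132 = x ^ 66 * x ^ 66 by ring, h66]
    linear_combination (-x ^ 8 + 2 * x ^ 7 + 2 * x ^ 6 - 2 * x ^ 5 + x ^ 4 - 2 * x ^ 3 - 2 * x ^ 2 -
      x - 1) * h + (x ^ 18 + 5 * x ^ 16 - 6 * x ^ 15 - 11 * x ^ 14 + 53 * x ^ 13 - 68 * x ^ 12 -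
      27 * x ^ 11 + 227 * x ^ 10 - 317 * x ^ 9 + 105 * x ^ 8 + 267 * x ^ 7 - 439 * x ^ 6 +
      318 * x ^ 5 - 121 * x ^ 4 - 35 * x ^ 3 + 82 * x ^ 2 - 49 * x + 49) * h5
  have h165 : x ^ 165 = x ^ 9 - 2 * x ^ 7 + 2 * x ^ 5 - x ^ 4 - 2 * x ^ 3 + x ^ 2 + x - 2 := by
    rw [show x ^ 165 = x ^ 132 * x ^ 33 by ring, h132, h33]
    linear_combination (2 * x ^ 8 + x ^ 7 + x ^ 6 + x ^ 5 + 2 * x ^ 4 + 2 * x ^ 3 + 2 * x ^ 2 -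
      2) * h + (2 * x ^ 17 - 6 * x ^ 16 + 3 * x ^ 15 + 17 * x ^ 14 - 42 * x ^ 13 + 30 * x ^ 12 +
      44 * x ^ 11 - 131 * x ^ 10 + 124 * x ^ 9 - 41 * x ^ 8 - 44 * x ^ 6 + 69 * x ^ 5 -
      113 * x ^ 4 + 62 * x ^ 3 + 65 * x ^ 2 - 194 * x + 98) * h5
  have h330 : x ^ 330 = -2 * x ^ 8 - x ^ 7 + x ^ 6 - 2 * x ^ 5 - 2 * x ^ 4 - 2 * x ^ 3 + 2 * x ^ 2 -
      x - 1 := by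
    rw [show x ^ 330 = x ^ 165 * x ^ 165 by ring, h165]
    linear_combination (x ^ 8 + x ^ 7 + 2 * x ^ 6 + 2 * x ^ 5 + x ^ 4 - 2 * x ^ 2 - x) * h +
      (x ^ 17 - 3 * x ^ 16 + x ^ 15 + 8 * x ^ 14 - 18 * x ^ 13 + 15 * x ^ 12 + 10 * x ^ 11 -
      48 * x ^ 10 + 73 * x ^ 9 - 73 * x ^ 8 + 47 * x ^ 7 - 7 * x ^ 6 - 63 * x ^ 5 + 96 * x ^ 4 -
      111 * x ^ 3 - x ^ 2 + 48 * x + 1) * h5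
  have h660 : x ^ 660 = x ^ 9 + x ^ 7 - 2 * x ^ 5 - x ^ 4 + 2 * x ^ 2 + 2 * x := by
    rw [show x ^ 660 = x ^ 330 * x ^ 330 by ring, h330]
    linear_combination (-x ^ 6 - 2 * x ^ 5 + x ^ 3 - 2 * x ^ 2 - x + 2) * h + (x ^ 16 + 5 * x ^ 13 -
      8 * x ^ 12 + 5 * x ^ 11 + 31 * x ^ 10 - 57 * x ^ 9 + 135 * x ^ 7 - 136 * x ^ 6 - 94 * x ^ 5 +
      293 * x ^ 4 - 126 * x ^ 3 - 163 * x ^ 2 + 243 * x - 97) * h5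
  have h1320 : x ^ 1320 = x ^ 9 - 2 * x ^ 8 + 2 * x ^ 7 + x ^ 6 - 2 * x ^ 5 - 2 * x ^ 2 - 2 * x +
      1 := by
    rw [show x ^ 1320 = x ^ 660 * x ^ 660 by ring, h660]
    linear_combination (x ^ 8 + x ^ 7 - 2 * x ^ 6 - 2 * x ^ 5 + x ^ 4 + 2 * x ^ 2 - 2) * h +
      (x ^ 17 - x ^ 16 - 3 * x ^ 15 + 13 * x ^ 14 - 14 * x ^ 13 - 25 * x ^ 12 + 81 * x ^ 11 -
      58 * x ^ 10 - 91 * x ^ 9 + 223 * x ^ 8 - 119 * x ^ 7 - 148 * x ^ 6 + 280 * x ^ 5 -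
      259 * x ^ 4 + 160 * x ^ 3 + 66 * x ^ 2 - 194 * x + 97) * h5
  generalize x ^ 1320 = y at h1320 ⊢
  have y2 : y ^ 2 = 2 * x ^ 9 + 2 * x ^ 8 - x ^ 6 - x ^ 5 + 2 * x ^ 4 - x ^ 3 - x := by
    rw [show y ^ 2 = y * y by ring, h1320]
    linear_combination (x ^ 8 + 2 * x ^ 7 - x ^ 5 + x ^ 4 + x ^ 2 - 2 * x + 2) * h + (x ^ 16 -
      5 * x ^ 15 + 10 * x ^ 14 - 2 * x ^ 13 - 32 * x ^ 12 + 61 * x ^ 11 - 16 * x ^ 10 -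
      104 * x ^ 9 + 147 * x ^ 8 - 34 * x ^ 7 - 85 * x ^ 6 + 64 * x ^ 5 - 116 * x ^ 4 + 297 * x ^ 3 -
      405 * x ^ 2 + 291 * x - 97) * h5
  have y3 : y ^ 3 = -2 * x ^ 8 - x ^ 6 - 2 * x ^ 5 + 2 * x ^ 4 + x ^ 3 + x ^ 2 - 2 * x - 2 := by
    rw [show y ^ 3 = y * y ^ 2 by ring, y2, h1320]
    linear_combination (2 * x ^ 8 + x ^ 4 - x ^ 3 + 2 * x ^ 2 - 1) * h + (2 * x ^ 17 - 6 * x ^ 16 +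
      5 * x ^ 15 + 16 * x ^ 14 - 49 * x ^ 13 + 43 * x ^ 12 + 44 * x ^ 11 - 163 * x ^ 10 +
      163 * x ^ 9 - 27 * x ^ 8 - 58 * x ^ 7 - 58 * x ^ 6 + 239 * x ^ 5 - 332 * x ^ 4 + 225 * x ^ 3 -
      16 * x ^ 2 - 97 * x + 49) * h5
  have y4 : y ^ 4 = 2 * x ^ 8 - 2 * x ^ 7 + 2 * x ^ 5 - 2 * x ^ 4 - 2 * x ^ 2 - 2 * x - 1 := by
    rw [show y ^ 4 = y ^ 2 * y ^ 2 by ring, y2]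
    linear_combination (-x ^ 8 + 2 * x ^ 7 + x ^ 6 + 2 * x ^ 5 - 2 * x ^ 4 - x ^ 3 + 2 * x ^ 2 -
      2 * x + 2) * h + (x ^ 18 + 6 * x ^ 16 - 8 * x ^ 15 - 6 * x ^ 14 + 36 * x ^ 13 - 57 * x ^ 12 +
      24 * x ^ 11 + 63 * x ^ 10 - 139 * x ^ 9 + 181 * x ^ 8 - 285 * x ^ 7 + 406 * x ^ 6 -
      275 * x ^ 5 - 148 * x ^ 4 + 441 * x ^ 3 - 453 * x ^ 2 + 292 * x - 97) * h5
  have y5 : y ^ 5 = x ^ 9 - 2 * x ^ 8 - x ^ 7 + 2 * x ^ 6 - x ^ 5 - 2 * x ^ 3 + x ^ 2 - 2 * x - 2 := by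
    rw [show y ^ 5 = y ^ 2 * y ^ 3 by ring, y3, y2]
    linear_combination (x ^ 7 + 2 * x ^ 6 + x ^ 4 - x ^ 3 - x ^ 2 + x - 1) * h + (-x ^ 17 - x ^ 15 -
      5 * x ^ 14 + 14 * x ^ 13 - 12 * x ^ 12 - 20 * x ^ 11 + 77 * x ^ 10 - 87 * x ^ 9 - 18 * x ^ 8 +
      171 * x ^ 7 - 253 * x ^ 6 + 209 * x ^ 5 - 72 * x ^ 4 - 147 * x ^ 3 + 227 * x ^ 2 - 145 * x +
      49) * h5
  have y6 : y ^ 6 = -x ^ 9 - 2 * x ^ 8 - 2 * x ^ 7 + x ^ 6 - x ^ 5 + 2 * x ^ 3 - 2 * x ^ 2 := by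
    rw [show y ^ 6 = y ^ 3 * y ^ 3 by ring, y3]
    linear_combination (-x ^ 6 - x ^ 5 - 2 * x ^ 4 + x ^ 3 - 2 * x ^ 2 + 2 * x - 2) * h + (x ^ 16 -
      x ^ 15 + 3 * x ^ 14 - 4 * x ^ 12 + 7 * x ^ 11 - 6 * x ^ 10 + 3 * x ^ 9 - 16 * x ^ 8 +
      36 * x ^ 7 + 19 * x ^ 6 - 163 * x ^ 5 + 341 * x ^ 4 - 443 * x ^ 3 + 454 * x ^ 2 - 290 * x +
      98) * h5
  have y7 : y ^ 7 = 2 * x ^ 9 + x ^ 8 - 2 * x ^ 7 + x ^ 6 + 2 * x ^ 5 - 2 * x ^ 4 - 2 * x ^ 2 +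
      2 * x := by
    rw [show y ^ 7 = y ^ 3 * y ^ 4 by ring, y4, y3]
    linear_combination (x ^ 6 - 2 * x ^ 4 + 2 * x ^ 3 + x - 1) * h + (-x ^ 16 + 2 * x ^ 15 -
      3 * x ^ 14 - 2 * x ^ 13 + 19 * x ^ 12 - 36 * x ^ 11 + 14 * x ^ 10 + 81 * x ^ 9 - 175 * x ^ 8 +
      119 * x ^ 7 + 115 * x ^ 6 - 308 * x ^ 5 + 285 * x ^ 4 - 196 * x ^ 3 + 180 * x ^ 2 - 145 * x +
      49) * h5
  have y8 : y ^ 8 = x ^ 9 - x ^ 8 - x ^ 7 + x ^ 5 + 2 * x + 2 := by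
    rw [show y ^ 8 = y ^ 4 * y ^ 4 by ring, y4]
    linear_combination (-x ^ 6 + x ^ 5 - 2 * x ^ 3 + x ^ 2 - 2) * h + (x ^ 16 - 3 * x ^ 15 +
      5 * x ^ 14 - 3 * x ^ 13 - 12 * x ^ 12 + 42 * x ^ 11 - 57 * x ^ 10 - 12 * x ^ 9 + 165 * x ^ 8 -
      257 * x ^ 7 + 118 * x ^ 6 + 182 * x ^ 5 - 323 * x ^ 4 + 160 * x ^ 3 + 115 * x ^ 2 - 194 * x +
      97) * h5
  have y9 : y ^ 9 = 2 * x ^ 9 + 2 * x ^ 8 + 2 * x ^ 7 - 2 * x ^ 6 + 2 * x ^ 5 + 2 * x ^ 4 +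
      2 * x ^ 3 - x ^ 2 + 2 * x - 1 := by
    rw [show y ^ 9 = y ^ 4 * y ^ 5 by ring, y5, y4]
    linear_combination (2 * x ^ 7 + x ^ 6 - 2 * x ^ 5 + x ^ 4 + x ^ 3 + x ^ 2 + 1) * h + (x ^ 16 -
      4 * x ^ 15 + 23 * x ^ 13 - 47 * x ^ 12 + 8 * x ^ 11 + 118 * x ^ 10 - 207 * x ^ 9 +
      81 * x ^ 8 + 183 * x ^ 7 - 274 * x ^ 6 + 107 * x ^ 5 - 7 * x ^ 4 + 67 * x ^ 3 - 128 * x ^ 2 +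
      98 * x - 48) * h5
  linear_combination (4 * x ^ 8 + x ^ 7 - 2 * x ^ 6 + 2 * x ^ 5) * h5 + y9 - y8 - y7 - 2 * y6 -
    2 * y5 + 2 * y4 - y3 + y2 - h1320

theorem Polynomial.Monic.finrank_le_natDegree {F A : Type*} [Field F] [CommRing A] [Algebra F A]
    {G : F[X]} (hG : G.Monic) {y : A} (hy : aeval y G = 0)
    (hsurj : Function.Surjective (aeval (R := F) y)) : Module.finrank F A ≤ G.natDegree := by
  have : Module.Finite F (AdjoinRoot G) := hG.finite_adjoinRoot
  rw [← AdjoinRoot.powerBasis_dim hG.ne_zero, ← PowerBasis.finrank]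
  let φ : AdjoinRoot G →ₐ[F] A := AdjoinRoot.liftAlgHom G (Algebra.ofId F A) y hy
  refine LinearMap.finrank_le_finrank_of_surjective (f := φ.toLinearMap) fun z => ?_
  obtain ⟨q, rfl⟩ := hsurj z
  exact ⟨AdjoinRoot.mk G q, AdjoinRoot.liftAlgHom_mk (p := G) (h := hy) ..⟩

theorem aeval_root_map_castRingHom (R : Type*) [CommRing R] (f : ℤ[X]) :
    aeval (AdjoinRoot.root (f.map (Int.castRingHom R))) f = 0 := by
  have h := AdjoinRoot.eval₂_root (f.map (Int.castRingHom R))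
  rw [eval₂_map, Subsingleton.elim (RingHom.comp _ _) (algebraMap ℤ _)] at h
  exact h

/-- Reduction modulo `5` shows that `n`-th powers of roots of `weilP` have degree at least `10`. -/
theorem ten_le_natDegree_of_weilP_dvd_expand {G : ℤ[X]} (hG : G.Monic) {n : ℕ} (hn : n ∣ 1320)
    (h : weilP ∣ expand ℤ n G) : 10 ≤ G.natDegree := by
  have hprime : Fact (Nat.Prime 5) := ⟨by norm_num⟩
  set P := weilP.map (Int.castRingHom (ZMod 5)) with hPdef
  have hP : P.Monic := monic_weilP.map _
  set x := AdjoinRoot.root P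
  have hx : aeval x weilP = 0 := aeval_root_map_castRingHom (ZMod 5) weilP
  have hfin : Module.finrank (ZMod 5) (AdjoinRoot P) = 10 := by
    rw [(AdjoinRoot.powerBasis hP.ne_zero).finrank, AdjoinRoot.powerBasis_dim, hPdef,
      monic_weilP.natDegree_map, natDegree_weilP]
  have haeval (y : AdjoinRoot P) (f : ℤ[X]) :
      aeval y (f.map (Int.castRingHom (ZMod 5))) = aeval y f :=
    aeval_map_algebraMap (ZMod 5) y f
  rw [← hfin, ← hG.natDegree_map (Int.castRingHom (ZMod 5))]
  refine (hG.map _).finrank_le_natDegree (y := x ^ n) ?_ fun z => ?_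
  · obtain ⟨q, hq⟩ := h
    rw [haeval, ← expand_aeval, hq, map_mul, hx, zero_mul]
  · have h5 : (5 : AdjoinRoot P) = 0 := by
      rw [← map_ofNat (algebraMap (ZMod 5) (AdjoinRoot P)) 5,
        show (OfNat.ofNat 5 : ZMod 5) = 0 from rfl, map_zero]
    obtain ⟨c, hc⟩ := exists_aeval_pow_eq_of_root_weilP h5 hx
    obtain ⟨m, hm⟩ := hn
    obtain ⟨q, rfl⟩ := AdjoinRoot.mk_surjective z
    refine ⟨q.comp ((expand ℤ m c).map (Int.castRingHom (ZMod 5))), ?_⟩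
    rw [aeval_comp, haeval, expand_aeval, ← pow_mul, ← hm]
    exact (congrArg (fun w => aeval w q) hc).trans (AdjoinRoot.aeval_eq q)

theorem ten_le_natDegree_of_aeval_root_pow_eq_zero {G : ℤ[X]} (hG : G.Monic) {n : ℕ}
    (hn : n ∣ 1320) (h : aeval (AdjoinRoot.root (weilP.map (Int.castRingHom ℚ)) ^ n) G = 0) :
    10 ≤ G.natDegree := by
  refine ten_le_natDegree_of_weilP_dvd_expand hG hn ?_
  rw [← map_dvd_map _ (RingHom.injective_int (Int.castRingHom ℚ)) monic_weilP,
    ← AdjoinRoot.mk_eq_zero, ← AdjoinRoot.aeval_eq]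
  rw [← expand_aeval] at h
  simpa [← algebraMap_int_eq, aeval_map_algebraMap] using h

theorem ne_expand_of_aeval_root_pow_eq_zero {Q : ℤ[X]} (hQ : Q.Monic) (hdeg : Q.natDegree = 10)
    {r : ℕ} (hr : r ∣ 132)
    (h : aeval (AdjoinRoot.root (weilP.map (Int.castRingHom ℚ)) ^ r) Q = 0)
    (g : ℤ[X]) (k : ℕ) (hk : 2 ≤ k) : Q ≠ expand ℤ k g := by
  rintro rfl
  rw [natDegree_expand] at hdeg
  have hg : g.Monic := by
    rwa [Monic, leadingCoeff_expand (by omega)] at hQ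
  have := ten_le_natDegree_of_aeval_root_pow_eq_zero hg
    (Nat.mul_dvd_mul hr (Dvd.intro_left _ hdeg)) (by rwa [pow_mul, ← expand_aeval])
  nlinarith

theorem weilP_extensions_irreducible :
    ∀ r ∈ ({2, 3, 4, 6, 11, 22} : Finset ℕ),
      ∃ Q : Polynomial ℤ,
        Q.map (Int.castRingHom ℂ) =
          (((weilP.map (Int.castRingHom ℂ)).roots).map
            (fun ω => (X : Polynomial ℂ) - C (ω ^ r))).prod ∧
        Irreducible (Q.map (Int.castRingHom ℚ)) ∧
        ∀ (g : Polynomial ℤ) (k : ℕ), 2 ≤ k → Q ≠ Polynomial.expand ℤ k g := by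
  intro r hr
  have hr : r ∣ 132 := by revert r; decide
  set p := weilP.map (Int.castRingHom ℚ) with hp
  have hpirr : Irreducible p :=
    monic_weilP.irreducible_iff_irreducible_map_fraction_map.mp irreducible_weilP
  have : Fact (Irreducible p) := ⟨hpirr⟩
  have : Module.Finite ℚ (AdjoinRoot p) := (monic_weilP.map _).finite_adjoinRoot
  set α := AdjoinRoot.root p ^ r
  have hint : IsIntegral ℤ α :=
    IsIntegral.pow ⟨weilP, monic_weilP, aeval_root_map_castRingHom ℚ weilP⟩ r
  have hfin : Module.finrank ℚ (AdjoinRoot p) = 10 := by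
    rw [(AdjoinRoot.powerBasis hpirr.ne_zero).finrank, AdjoinRoot.powerBasis_dim, hp,
      monic_weilP.natDegree_map, natDegree_weilP]
  set Q := minpoly ℤ α
  have hQ : Q.Monic := minpoly.monic hint
  have hQ0 : aeval α Q = 0 := minpoly.aeval ℤ α
  have hmap : minpoly ℚ α = Q.map (Int.castRingHom ℚ) :=
    minpoly.isIntegrallyClosed_eq_field_fractions' ℚ hint
  have hdeg : Q.natDegree = 10 := by
    refine le_antisymm ?_
      (ten_le_natDegree_of_aeval_root_pow_eq_zero hQ (hr.trans (by norm_num)) hQ0)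
    rw [← hfin, ← hQ.natDegree_map (Int.castRingHom ℚ), ← hmap]
    exact minpoly.natDegree_le α
  refine ⟨Q, ?_, hmap ▸ minpoly.irreducible hint.tower_top,
    ne_expand_of_aeval_root_pow_eq_zero hQ hdeg hr hQ0⟩
  have htop : Algebra.adjoin ℚ {α} = ⊤ := by
    have h := (Field.primitive_element_iff_minpoly_natDegree_eq ℚ α).mpr
      (by rw [hmap, hQ.natDegree_map, hdeg, hfin])
    rw [← IntermediateField.adjoin_simple_toSubalgebra_of_isAlgebraic
      (Algebra.IsAlgebraic.isAlgebraic α), h, IntermediateField.top_toSubalgebra]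
  obtain ⟨q, hq⟩ : ∃ q : ℚ[X], aeval α q = AdjoinRoot.root p := by
    have hmem : AdjoinRoot.root p ∈ Algebra.adjoin ℚ {α} := htop ▸ Algebra.mem_top
    rwa [Algebra.adjoin_singleton_eq_range_aeval] at hmem
  set s := (weilP.map (Int.castRingHom ℂ)).roots
  have hs {ω : ℂ} (hω : ω ∈ s) : ∃ φ : AdjoinRoot p →ₐ[ℚ] ℂ, φ (AdjoinRoot.root p) = ω := by
    have h0 : eval₂ (Algebra.ofId ℚ ℂ : ℚ →+* ℂ) ω p = 0 := by
      have h1 := isRoot_of_mem_roots hω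
      rw [IsRoot, eval_map] at h1
      rwa [hp, eval₂_map, Subsingleton.elim (RingHom.comp _ _) (Int.castRingHom ℂ)]
    exact ⟨AdjoinRoot.liftAlgHom p _ ω h0, AdjoinRoot.liftAlgHom_root ..⟩
  have hroot {ω : ℂ} (hω : ω ∈ s) : aeval (ω ^ r) Q = 0 := by
    obtain ⟨φ, rfl⟩ := hs hω
    rw [← aeval_map_algebraMap ℚ, algebraMap_int_eq, ← hmap, ← map_pow, aeval_algHom_apply,
      minpoly.aeval, map_zero]
  have hinj : ∀ ω ∈ s, ∀ ω' ∈ s, ω ^ r = ω' ^ r → ω = ω' := by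
    have h {ω : ℂ} (hω : ω ∈ s) : aeval (ω ^ r) q = ω := by
      obtain ⟨φ, rfl⟩ := hs hω
      rw [← map_pow, aeval_algHom_apply, hq]
    intro ω hω ω' hω' heq
    rw [← h hω, heq, h hω']
  have hnodup : (s.map (· ^ r)).Nodup := by
    refine Multiset.Nodup.map_on hinj (nodup_roots ?_)
    have := hpirr.separable.map (f := algebraMap ℚ ℂ)
    rwa [hp, map_map, Subsingleton.elim (RingHom.comp _ _) (Int.castRingHom ℂ)] at this
  have hcard : s.card = 10 := by
    rw [← natDegree_weilP, ← monic_weilP.natDegree_map (Int.castRingHom ℂ)]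
    exact (IsAlgClosed.splits _).natDegree_eq_card_roots.symm
  have hQC : (Q.map (Int.castRingHom ℂ)).Splits := IsAlgClosed.splits _
  have hroots : s.map (· ^ r) = (Q.map (Int.castRingHom ℂ)).roots := by
    refine Multiset.eq_of_le_of_card_le ((Multiset.le_iff_subset hnodup).mpr fun z hz => ?_) ?_
    · obtain ⟨ω, hω, rfl⟩ := Multiset.mem_map.mp hz
      rw [mem_roots (hQ.map _).ne_zero, IsRoot, eval_map]
      exact hroot hω
    · rw [← hQC.natDegree_eq_card_roots, hQ.natDegree_map, hdeg, Multiset.card_map, hcard]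
  rw [hQC.eq_prod_roots_of_monic (hQ.map _), ← hroots, Multiset.map_map]
  rfl
end
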